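/- Let A be a unital C*-algebra with unit 1 and let X be a unital Banach A-bimodule. Then a bounded linear operator T : A → X is anti-derivable at zero if, and only if, there exist an element η ∈ X and an anti-derivation d : A → X satisfying η·a = a·η for all a ∈ A, η·[a, b] = 0 for all a, b ∈ A, and T(a) = d(a) + η·a for all a ∈ A. Moreover, in this case η = T(1). -/

import Mathlib

theorem lemA_step {K E : Type*} [TopologicalSpace K] [CompactSpace K]
    [NormedAddCommGroup E] [NormedSpace ℝ E]
    (ψ : C(K,ℝ) →ₗ[ℝ] C(K,ℝ) →ₗ[ℝ] E) (C : ℝ) (hC0 : 0 ≤ C)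
    (hC : ∀ f g, ‖ψ f g‖ ≤ C * ‖f‖ * ‖g‖)
    (hz : ∀ f g, f * g = 0 → ψ f g = 0)
    (v P Y : C(K,ℝ)) (hP : ‖P‖ ≤ 1) (hY : ‖v - Y‖ ≤ 2)
    (hint : ∀ x, P x ≠ 0 → ∃ n : ℤ, Y x = n) :
    ‖ψ (P * v) 1 - ψ P v‖ ≤ 4 * C := by
  have key : ψ (P * Y) 1 = ψ P Y := by
    obtain ⟨M, hM⟩ := exists_nat_ge ‖Y‖
    let p : ℤ → C(K,ℝ) := fun i => P * ⟨fun x => max 0 (1 - |Y x - i|), by fun_prop⟩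
    have hp0 : ∀ i, p i * (Y - algebraMap ℝ _ (i:ℝ)) = 0 := by
      intro i
      ext x
      by_cases hx : P x = 0
      · simp [p, hx]
      obtain ⟨n, hn⟩ := hint x hx
      simp only [p, ContinuousMap.mul_apply, ContinuousMap.coe_mk, ContinuousMap.sub_apply, hn,
        ContinuousMap.zero_apply, Algebra.algebraMap_eq_smul_one, ContinuousMap.smul_apply,
        ContinuousMap.one_apply, smul_eq_mul, mul_one]
      by_cases hni : n = i
      · simp [hni]
      · have : (1:ℝ) ≤ |(n:ℝ) - i| := by
          have : (1:ℤ) ≤ |n - i| := Int.one_le_abs (sub_ne_zero.mpr hni)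
          exact_mod_cast this
        rw [max_eq_left (by linarith)]; simp
    have hps : ∑ i ∈ Finset.Icc (-(M:ℤ)) M, p i = P := by
      ext x
      by_cases hx : P x = 0
      · simp [p, hx]
      obtain ⟨n, hn⟩ := hint x hx
      have hnM : |(n:ℝ)| ≤ M := by
        rw [← hn]; exact (Y.norm_coe_le_norm x).trans hM
      have hnM' : |n| ≤ (M:ℤ) := by exact_mod_cast hnM
      have hmem : n ∈ Finset.Icc (-(M:ℤ)) M := by
        rw [Finset.mem_Icc]; exact abs_le.mp hnM'
      rw [ContinuousMap.sum_apply, Finset.sum_eq_single_of_mem n hmem]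
      · simp [p, hn]
      · intro i _ hni
        have : (1:ℝ) ≤ |(n:ℝ) - i| := by
          have : (1:ℤ) ≤ |n - i| := Int.one_le_abs (sub_ne_zero.mpr hni.symm)
          exact_mod_cast this
        simp only [p, ContinuousMap.mul_apply, ContinuousMap.coe_mk, hn]
        rw [max_eq_left (by linarith)]; simp
    have hi : ∀ i, ψ (p i * Y) 1 = ψ (p i) Y := by
      intro i
      have h1 : p i * Y = (i:ℝ) • p i := by
        have := hp0 i
        rw [mul_sub, sub_eq_zero] at this
        rw [this, mul_comm, ← Algebra.smul_def]
      have h2 := hz _ _ (hp0 i)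
      rw [map_sub, sub_eq_zero, Algebra.algebraMap_eq_smul_one, map_smul] at h2
      rw [h1, map_smul, h2]; rfl
    rw [← hps, Finset.sum_mul, map_sum, map_sum, LinearMap.sum_apply, LinearMap.sum_apply]
    exact Finset.sum_congr rfl (fun i _ => hi i)
  have e : ψ (P * v) 1 - ψ P v = ψ (P * (v - Y)) 1 - ψ P (v - Y) := by
    rw [mul_sub, map_sub, map_sub, LinearMap.sub_apply, key]; abel
  rw [e]
  have h1 : ‖(1 : C(K,ℝ))‖ ≤ 1 := by
    rw [ContinuousMap.norm_le _ zero_le_one]; simp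
  have hPv : ‖P * (v - Y)‖ ≤ 2 := by
    calc _ ≤ ‖P‖ * ‖v - Y‖ := norm_mul_le _ _
      _ ≤ 1 * 2 := by gcongr
      _ = 2 := by norm_num
  calc _ ≤ ‖ψ (P * (v - Y)) 1‖ + ‖ψ P (v - Y)‖ := norm_sub_le _ _
    _ ≤ C * 2 * 1 + C * 1 * 2 := by
        gcongr
        · exact (hC _ _).trans (by gcongr)
        · exact (hC _ _).trans (by gcongr)
    _ = 4 * C := by ring

theorem stair_cont : Continuous (fun x : ℝ => x + (max 0 (4 * Int.fract x - 3) - Int.fract x)) := by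
  refine continuous_id.add ?_
  have := ContinuousOn.comp_fract'' (f := fun t : ℝ => max 0 (4 * t - 3) - t) (by fun_prop) (by norm_num)
  exact this

theorem bump_cont : Continuous (fun x : ℝ => max 0 (min 1 (min (4 * Int.fract x) (3 - 4 * Int.fract x)))) := by
  exact ContinuousOn.comp_fract'' (f := fun t : ℝ => max 0 (min 1 (min (4 * t) (3 - 4 * t)))) (by fun_prop) (by norm_num)

theorem stair_near (x : ℝ) : |(max 0 (4 * Int.fract x - 3) - Int.fract x)| ≤ 1 := by
  have h0 := Int.fract_nonneg x
  have h1 := Int.fract_lt_one x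
  rw [abs_le]
  constructor
  · have := le_max_left 0 (4 * Int.fract x - 3)
    linarith
  · have : max 0 (4 * Int.fract x - 3) ≤ 1 := max_le (by norm_num) (by linarith)
    linarith

theorem stair_int (x : ℝ) (h : Int.fract x ≤ 3/4) :
    x + (max 0 (4 * Int.fract x - 3) - Int.fract x) = (⌊x⌋ : ℤ) := by
  rw [max_eq_left (by linarith)]
  have := Int.floor_add_fract x
  linarith

theorem fract_half (x : ℝ) (h : Int.fract x < 1/4 ∨ 1/2 < Int.fract x) :
    Int.fract (x + 1/2) ≤ 3/4 := by
  have h0 := Int.fract_nonneg x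
  have h1 := Int.fract_lt_one x
  have h2 := Int.floor_add_fract x
  rcases h with h | h
  · have : Int.fract (x + 1/2) = Int.fract x + 1/2 := by
      rw [Int.fract_eq_iff]
      exact ⟨by linarith, by linarith, ⌊x⌋, by linarith⟩
    linarith
  · have : Int.fract (x + 1/2) = Int.fract x - 1/2 := by
      rw [Int.fract_eq_iff]
      exact ⟨by linarith, by linarith, ⌊x⌋ + 1, by push_cast; linarith⟩
    linarith

theorem lemA {K E : Type*} [TopologicalSpace K] [CompactSpace K]
    [NormedAddCommGroup E] [NormedSpace ℝ E]
    (ψ : C(K,ℝ) →ₗ[ℝ] C(K,ℝ) →ₗ[ℝ] E) (C : ℝ) (hC0 : 0 ≤ C)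
    (hC : ∀ f g, ‖ψ f g‖ ≤ C * ‖f‖ * ‖g‖)
    (hz : ∀ f g, f * g = 0 → ψ f g = 0) (u : C(K,ℝ)) : ψ u 1 = ψ 1 u := by
  have bd : ∀ v : C(K,ℝ), ‖ψ v 1 - ψ 1 v‖ ≤ 8 * C := by
    intro v
    let P : C(K,ℝ) := (⟨_, bump_cont⟩ : C(ℝ,ℝ)).comp v
    let Y1 : C(K,ℝ) := (⟨_, stair_cont⟩ : C(ℝ,ℝ)).comp v
    let Y2 : C(K,ℝ) := (⟨_, stair_cont⟩ : C(ℝ,ℝ)).comp (v + ContinuousMap.const K (1/2))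
    have hP0 : ∀ x, 0 ≤ P x := fun x => le_max_left _ _
    have hP1 : ∀ x, P x ≤ 1 := fun x => max_le (by norm_num) (min_le_left _ _)
    have s1 := lemA_step ψ C hC0 hC hz v P Y1
      (by rw [ContinuousMap.norm_le _ zero_le_one]
          intro x; rw [Real.norm_eq_abs, abs_le]; exact ⟨by linarith [hP0 x], hP1 x⟩)
      (by rw [ContinuousMap.norm_le _ zero_le_two]
          intro x
          have := stair_near (v x)
          simp only [Y1, ContinuousMap.sub_apply, ContinuousMap.comp_apply, ContinuousMap.coe_mk,
            Real.norm_eq_abs, sub_add_cancel_left, abs_neg]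
          linarith)
      (by intro x hx
          refine ⟨_, stair_int (v x) ?_⟩
          by_contra hc
          push Not at hc
          apply hx
          simp only [P, ContinuousMap.comp_apply, ContinuousMap.coe_mk]
          apply max_eq_left
          exact (min_le_right _ _).trans ((min_le_right _ _).trans (by linarith)))
    have s2 := lemA_step ψ C hC0 hC hz v (1 - P) Y2
      (by rw [ContinuousMap.norm_le _ zero_le_one]
          intro x; rw [Real.norm_eq_abs, abs_le]
          simp only [ContinuousMap.sub_apply, ContinuousMap.one_apply]
          exact ⟨by linarith [hP1 x], by linarith [hP0 x]⟩)
      (by rw [ContinuousMap.norm_le _ zero_le_two]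
          intro x
          have := abs_le.mp (stair_near (v x + 1/2))
          simp only [Y2, ContinuousMap.sub_apply, ContinuousMap.comp_apply, ContinuousMap.coe_mk,
            Real.norm_eq_abs, ContinuousMap.add_apply, ContinuousMap.const_apply]
          rw [abs_le]
          constructor <;> linarith)
      (by intro x hx
          refine ⟨_, stair_int (v x + 1/2) (fract_half _ ?_)⟩
          by_contra hc
          push Not at hc
          apply hx
          have : P x = 1 := by
            simp only [P, ContinuousMap.comp_apply, ContinuousMap.coe_mk]
            rw [min_eq_left, max_eq_right (by norm_num)]
            exact le_min (by linarith) (by linarith)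
          simp [this])
    have e : ψ v 1 - ψ 1 v = (ψ (P * v) 1 - ψ P v) + (ψ ((1 - P) * v) 1 - ψ (1 - P) v) := by
      rw [sub_mul, one_mul]
      simp only [map_sub, LinearMap.sub_apply]
      abel
    rw [e]
    refine (norm_add_le _ _).trans ?_
    linarith
  rw [← sub_eq_zero, ← norm_eq_zero]
  by_contra hne
  have hpos : 0 < ‖ψ u 1 - ψ 1 u‖ := lt_of_le_of_ne (norm_nonneg _) (Ne.symm hne)
  obtain ⟨N, hN⟩ := exists_nat_gt (8 * C / ‖ψ u 1 - ψ 1 u‖)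
  have := bd ((N:ℝ) • u)
  rw [map_smul, map_smul, LinearMap.smul_apply, ← smul_sub, norm_smul, Real.norm_natCast] at this
  rw [div_lt_iff₀ hpos] at hN
  linarith

theorem propB {A X : Type*} [CStarAlgebra A]
    [NormedAddCommGroup X] [NormedSpace ℂ X]
    (φ : A →L[ℂ] A →L[ℂ] X) (hφ : ∀ a b, a * b = 0 → φ a b = 0) (a u b : A) :
    φ (a * u) b = φ a (u * b) := by
  have sa : ∀ h : A, IsSelfAdjoint h → φ (a * h) b = φ a (h * b) := by
    intro h hh
    let F := cfcHom (R := ℝ) hh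
    let ψ : C(spectrum ℝ h,ℝ) →ₗ[ℝ] C(spectrum ℝ h,ℝ) →ₗ[ℝ] X :=
      LinearMap.mk₂ ℝ (fun f g => φ (a * F f) (F g * b))
        (by intro f f' g; simp [mul_add])
        (by intro c f g; rw [map_smul, mul_smul_comm];
            rw [← Complex.coe_smul, ← Complex.coe_smul, map_smul]; rfl)
        (by intro f f' g; simp [add_mul])
        (by intro c f g; rw [map_smul, smul_mul_assoc]
            rw [← Complex.coe_smul, ← Complex.coe_smul, map_smul])
    have := lemA ψ (‖φ‖ * ‖a‖ * ‖b‖) (by positivity)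
      (by intro f g
          have h1 : ‖F f‖ = ‖f‖ := norm_cfcHom (𝕜 := ℝ) h f hh
          have h2 : ‖F g‖ = ‖g‖ := norm_cfcHom (𝕜 := ℝ) h g hh
          calc ‖φ (a * F f) (F g * b)‖ ≤ ‖φ‖ * ‖a * F f‖ * ‖F g * b‖ := φ.le_opNorm₂ _ _
            _ ≤ ‖φ‖ * (‖a‖ * ‖F f‖) * (‖F g‖ * ‖b‖) := by
                gcongr <;> exact norm_mul_le _ _
            _ = _ := by rw [h1, h2]; ring)
      (by intro f g hfg
          apply hφ
          rw [mul_assoc, ← mul_assoc (F f), ← map_mul, hfg]; simp)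
      ((ContinuousMap.id ℝ).restrict (spectrum ℝ h))
    have e : F ((ContinuousMap.id ℝ).restrict (spectrum ℝ h)) = h := cfcHom_id hh
    simpa [ψ, e] using this
  have h := realPart_add_I_smul_imaginaryPart u
  rw [← h, mul_add, add_mul, map_add, map_add, add_apply,
    sa _ (realPart u).2, mul_smul_comm, smul_mul_assoc, map_smul, map_smul,
    smul_apply, sa _ (imaginaryPart u).2]

theorem sqrtIdeal {A X : Type*} [CStarAlgebra A]
    [NormedAddCommGroup X] [NormedSpace ℂ X]
    (L : A →L[ℂ] X) (hL : ∀ a b, L b = 0 → L (a * b) = 0) (h : A) (hh : IsSelfAdjoint h)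
    (h2 : L (h * h) = 0) : L h = 0 := by
  let F := cfcHom (R := ℝ) hh
  let x := (ContinuousMap.id ℝ).restrict (spectrum ℝ h)
  have e : F x = h := cfcHom_id hh
  have bd : ∀ ε : ℝ, 0 < ε → ‖L h‖ ≤ ‖L‖ * ε := by
    intro ε hε
    let g : C(spectrum ℝ h, ℝ) := ⟨fun t => (t:ℝ) / ((t:ℝ)^2 + ε^2), by
      refine Continuous.div (by fun_prop) (by fun_prop) ?_
      intro t; positivity⟩
    have h3 : L (F g * (h * h)) = 0 := hL _ _ h2
    have h4 : L h = L (F (x - g * (x * x))) := by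
      rw [map_sub, map_mul, map_mul, e, map_sub, h3, sub_zero]
    have h5 : ‖x - g * (x * x)‖ ≤ ε := by
      rw [ContinuousMap.norm_le _ hε.le]
      rintro ⟨t, ht⟩
      have : (x - g * (x * x)) ⟨t, ht⟩ = t - t / (t^2 + ε^2) * (t * t) := rfl
      rw [this]
      have hp : 0 < t^2 + ε^2 := by positivity
      have : t - t / (t^2 + ε^2) * (t * t) = ε * (ε * t) / (t^2+ε^2) := by
        field_simp; ring
      rw [this, Real.norm_eq_abs, abs_div, abs_of_pos hp, div_le_iff₀ hp, abs_mul, abs_of_pos hε]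
      gcongr
      rw [abs_le]; constructor <;> nlinarith [sq_nonneg (t - ε), sq_nonneg (t + ε)]
    rw [h4]
    refine (L.le_opNorm _).trans ?_
    gcongr
    rw [norm_cfcHom (𝕜 := ℝ) h _ hh]
    exact h5
  rw [← norm_eq_zero]
  refine le_antisymm ?_ (norm_nonneg _)
  refine le_of_forall_pos_le_add ?_
  intro δ hδ
  have := bd (δ / (‖L‖ + 1)) (by positivity)
  refine this.trans ?_
  rw [zero_add, mul_div_assoc', div_le_iff₀ (by positivity)]
  nlinarith [norm_nonneg L]

theorem algPart {A X : Type*} [CStarAlgebra A]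
    [NormedAddCommGroup X] [NormedSpace ℂ X]
    (l : A →L[ℂ] X →L[ℂ] X) (r : X →L[ℂ] A →L[ℂ] X)
    (hl : ∀ (a b : A) (x : X), l (a * b) x = l a (l b x))
    (hr : ∀ (x : X) (a b : A), r (r x a) b = r x (a * b))
    (hlr : ∀ (a : A) (x : X) (b : A), l a (r x b) = r (l a x) b)
    (hrone : ∀ x : X, r x 1 = x)
    (η : X) (hη : ∀ a, r η a = l a η) (d : A → X) (hsub : ∀ a b, d (a - b) = d a - d b)
    (hd : ∀ a b, d (a * b) = r (d b) a + l b (d a) - (2:ℂ) • r η (a * b - b * a))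
    (hs : ∀ a b c, r (d c) (a * b - b * a) + l (c * b - b * c) (d a) = 0) (a b : A) :
    r η (a * b - b * a) = 0 := by
  have hs' : ∀ a b c, r (d c) (a * b - b * a) = l (b * c - c * b) (d a) := by
    intro a b c
    rw [← neg_sub (c * b), map_neg, neg_apply, eq_neg_iff_add_eq_zero]
    exact hs a b c
  have anti : ∀ a b c, r (d c) (a * b - b * a) = - r (d c) (b * a - a * b) := by
    intro a b c
    rw [← neg_sub (b * a), map_neg]
  have antil : ∀ a b c, l (a * b - b * a) (d c) = - l (b * a - a * b) (d c) := by
    intro a b c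
    rw [← neg_sub (b * a), map_neg, neg_apply]
  have hc : ∀ a b c, r (d c) (a * b - b * a) = r (d a) (b * c - c * b) := by
    intro a b c
    rw [anti, hs' b a c, ← antil, ← hs' b c a]
  have q1 : ∀ a b, r (d a) (a * b - b * a) = 0 := by
    intro a b
    have h1 := hc a b a
    rw [anti b a] at h1
    have h2 : (2:ℂ) • r (d a) (a * b - b * a) = 0 := by
      rw [two_smul]
      exact eq_neg_iff_add_eq_zero.mp h1
    exact (smul_eq_zero.mp h2).resolve_left (by norm_num)
  have q2 : ∀ a b x, r (d a) (b * (a * x - x * a)) = 0 := by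
    intro a b x
    have e : b * (a * x - x * a) = (a * (b * x) - (b * x) * a) - (a * b - b * a) * x := by
      noncomm_ring
    rw [e, map_sub, q1, ← hr, q1]; simp
  have q2' : ∀ a b x, r (d x) (b * (a * x - x * a)) = 0 := by
    intro a b x
    rw [← neg_sub (x * a), mul_neg, map_neg, q2, neg_zero]
  have q3 : ∀ a x b, r (d (a * x - x * a)) (b * (a * x - x * a)) =
      - (4:ℂ) • r η ((a * x - x * a) * (b * (a * x - x * a))) := by
    intro a x b
    have e : d (a * x - x * a) = r (d x) a + l x (d a) - r (d a) x - l a (d x)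
        - (4:ℂ) • r η (a * x - x * a) := by
      rw [hsub, hd, hd, ← neg_sub (a * x) (x * a), map_neg]
      module
    have e0 : ∀ (K : A) (p q s t w : X), r (p + q - s - t - (4:ℂ) • w) K =
        r p K + r q K - r s K - r t K - (4:ℂ) • r w K := by
      intros
      simp only [map_sub, map_add, map_smul, sub_apply, add_apply, smul_apply]
    rw [e, e0]
    have e1 : r (r (d x) a) (b * (a * x - x * a)) = 0 := by
      rw [hr, ← mul_assoc, q2']
    have e2 : r (r (d a) x) (b * (a * x - x * a)) = 0 := by
      rw [hr, ← mul_assoc, q2]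
    rw [e1, e2, ← hlr, ← hlr, q2, q2', hr]
    simp
  have Lleft : ∀ a b, r η b = 0 → r η (a * b) = 0 := by
    intro a b h
    rw [← hr, hη, ← hlr, h, map_zero]
  have Lright : ∀ a b, r η a = 0 → r η (a * b) = 0 := by
    intro a b h
    rw [← hr, h]; simp
  have q4 : ∀ a x b y, r η ((a * x - x * a) *
      (b * ((a * x - x * a) * y - y * (a * x - x * a)))) = 0 := by
    intro a x b y
    have h1 := q2 (a * x - x * a) b y
    have h2 := q3 a x b
    have h3 := q3 a x (b * y)
    set k := a * x - x * a
    have e : b * (k * y - y * k) = (b * k) * y - (b * y) * k := by noncomm_ring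
    rw [e, map_sub, ← hr, h2, h3, map_smul, smul_apply, ← smul_sub, hr, ← map_sub,
      smul_eq_zero] at h1
    rw [e]
    have h4 := h1.resolve_left (by norm_num)
    rw [← h4]
    congr 1
    noncomm_ring
  have q5 : ∀ a x y, r η (((a * x - x * a) * y - y * (a * x - x * a)) *
      ((a * x - x * a) * y - y * (a * x - x * a))) = 0 := by
    intro a x y
    have h1 := q4 a x y y
    have h2 := q4 a x 1 y
    set k := a * x - x * a
    rw [one_mul] at h2
    have e : (k * y - y * k) * (k * y - y * k) =
      k * (y * (k * y - y * k)) - y * (k * (k * y - y * k)) := by noncomm_ring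
    rw [e, map_sub, h1, Lleft _ _ h2, sub_zero]
  have q6 : ∀ a x, IsSelfAdjoint a → IsSelfAdjoint x →
      r η ((a * x - x * a) * a - a * (a * x - x * a)) = 0 := by
    intro a x ha hx
    refine sqrtIdeal (r η) Lleft _ ?_ (q5 a x a)
    rw [isSelfAdjoint_iff]
    simp only [star_sub, star_mul, ha.star_eq, hx.star_eq]
    noncomm_ring
  have q7 : ∀ a x, IsSelfAdjoint a → IsSelfAdjoint x → r η (a * x - x * a) = 0 := by
    intro a x ha hx
    have h1 := q6 a x ha hx
    have h2 := q6 a (x * x) ha (by rw [isSelfAdjoint_iff, star_mul, hx.star_eq])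
    have e : (a * (x * x) - (x * x) * a) * a - a * (a * (x * x) - (x * x) * a) =
        ((a * x - x * a) * a - a * (a * x - x * a)) * x
        + x * ((a * x - x * a) * a - a * (a * x - x * a))
        - (2:ℂ) • ((a * x - x * a) * (a * x - x * a)) := by
      rw [two_smul]
      noncomm_ring
    rw [e, map_sub, map_add, Lright _ _ h1, Lleft _ _ h1, map_smul, add_zero, zero_sub,
      neg_eq_zero, smul_eq_zero] at h2
    have h3 := h2.resolve_left (by norm_num)
    have h4 := sqrtIdeal (r η) Lleft (Complex.I • (a * x - x * a)) (by
      rw [isSelfAdjoint_iff]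
      simp only [star_smul, star_sub, star_mul, ha.star_eq, hx.star_eq]
      simp [smul_sub]
      abel) (by
      rw [smul_mul_smul_comm, map_smul, h3, smul_zero])
    rw [map_smul, smul_eq_zero] at h4
    exact h4.resolve_left Complex.I_ne_zero
  have ea := realPart_add_I_smul_imaginaryPart a
  have eb := realPart_add_I_smul_imaginaryPart b
  have h1 := q7 _ _ (realPart a).2 (realPart b).2
  have h2 := q7 _ _ (realPart a).2 (imaginaryPart b).2
  have h3 := q7 _ _ (imaginaryPart a).2 (realPart b).2
  have h4 := q7 _ _ (imaginaryPart a).2 (imaginaryPart b).2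
  generalize (realPart a : A) = a1 at *
  generalize (realPart b : A) = b1 at *
  generalize (imaginaryPart a : A) = a2 at *
  generalize (imaginaryPart b : A) = b2 at *
  have e : a * b - b * a = (a1 * b1 - b1 * a1) + Complex.I • (a1 * b2 - b2 * a1)
    + Complex.I • (a2 * b1 - b1 * a2) + Complex.I • Complex.I • (a2 * b2 - b2 * a2) := by
    rw [← ea, ← eb]
    simp only [mul_add, add_mul, mul_smul_comm, smul_mul_assoc, smul_sub, smul_add]
    abel
  rw [e]
  simp only [map_add, map_smul, h1, h2, h3, h4, smul_zero, add_zero]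

/-- Let `A` be a unital C*-algebra and `X` a unital Banach `A`-bimodule (with
continuous left action `l` and right action `r`).  A bounded linear operator
`T : A → X` is anti-derivable at zero iff there exist `η ∈ X` and an
anti-derivation `d : A → X` with `η · a = a · η`, `η · [a,b] = 0`, and
`T a = d a + η · a` for all `a, b ∈ A`.  Moreover, in this case `η = T 1`. -/
theorem stmt_16 {A X : Type*} [CStarAlgebra A]
    [NormedAddCommGroup X] [NormedSpace ℂ X] [CompleteSpace X]
    (l : A →L[ℂ] X →L[ℂ] X) (r : X →L[ℂ] A →L[ℂ] X)
    (hl : ∀ (a b : A) (x : X), l (a * b) x = l a (l b x))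
    (hr : ∀ (x : X) (a b : A), r (r x a) b = r x (a * b))
    (hlr : ∀ (a : A) (x : X) (b : A), l a (r x b) = r (l a x) b)
    (hlone : ∀ x : X, l 1 x = x) (hrone : ∀ x : X, r x 1 = x)
    (T : A →L[ℂ] X) :
    ((∀ a b : A, a * b = 0 → r (T b) a + l b (T a) = 0) ↔
      ∃ (η : X) (d : A →ₗ[ℂ] X),
        (∀ a b : A, d (a * b) = r (d b) a + l b (d a)) ∧
        (∀ a : A, r η a = l a η) ∧
        (∀ a b : A, r η (a * b - b * a) = 0) ∧
        (∀ a : A, T a = d a + r η a)) ∧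
    (∀ (η : X) (d : A →ₗ[ℂ] X),
        (∀ a b : A, d (a * b) = r (d b) a + l b (d a)) →
        (∀ a : A, r η a = l a η) →
        (∀ a b : A, r η (a * b - b * a) = 0) →
        (∀ a : A, T a = d a + r η a) → η = T 1) := by
  refine ⟨⟨?_, ?_⟩, ?_⟩
  · intro h
    have hB : ∀ a u b, r (T b) (a * u) + l b (T (a * u)) = r (T (u * b)) a + l (u * b) (T a) := by
      let φ : A →L[ℂ] A →L[ℂ] X := (r.comp T).flip + (l.flip.comp T)
      intro a u b
      exact propB φ (fun a b hab => h a b hab) a u b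
    have h1 : ∀ a b, r (T b) a + l b (T a) = T (a * b) + r (T 1) (a * b) := by
      intro a b
      have := hB a b 1
      rw [hlone, mul_one] at this
      rw [← this, add_comm]
    have hη : ∀ a, r (T 1) a = l a (T 1) := by
      intro a
      have := h1 1 a
      rw [hrone, one_mul] at this
      exact (add_left_cancel this).symm
    have hd : ∀ a b, (T - r (T 1)) (a * b) = r ((T - r (T 1)) b) a + l b ((T - r (T 1)) a)
        - (2:ℂ) • r (T 1) (a * b - b * a) := by
      intro a b
      have := h1 a b
      simp only [sub_apply, map_sub, hr, hlr, ← hη]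
      linear_combination (norm := module) (-1 : ℂ) • this
    have hcomm : ∀ a b, r (T 1) (a * b - b * a) = 0 := by
      refine algPart l r hl hr hlr hrone (T 1) hη (⇑(T - r (T 1))) (fun a b => map_sub _ _ _) hd ?_
      intro a b c
      have e1 := hB a b c
      have e2 := h1 a b
      have e3 := h1 b c
      have e2' := congrArg (l c) e2
      have e3' := congrArg (fun x => r x a) e3
      simp only [sub_apply, map_sub, map_add, add_apply, hl, ← hr, hlr, ← hη] at *
      linear_combination (norm := module) e1 + e2' - e3'
    refine ⟨T 1, (T - r (T 1) : A →L[ℂ] X).toLinearMap, ?_, hη, hcomm, ?_⟩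
    · intro a b
      have := hd a b
      rw [hcomm, smul_zero, sub_zero] at this
      exact this
    · intro a
      simp
  · rintro ⟨η, d, hd, hη, hc, hT⟩ a b hab
    have h1 := hd a b
    have h2 := hc a b
    rw [hab, zero_sub, map_neg, neg_eq_zero] at h2
    rw [hab, map_zero] at h1
    rw [hT, hT, map_add, map_add, add_apply, hr, hlr, ← hη, hr, h2, add_zero, add_zero, ← h1]
  · intro η d hd hη hc hT
    have h1 := hd 1 1
    rw [hrone, hlone, mul_one] at h1
    rw [hT, hrone, left_eq_add.mp h1, zero_add]
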